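/- Let λ = (λ_1 ≥ ... ≥ λ_{mn}) be a dominant integral weight for GL_{mn}(ℂ) such that the integers λ_i + (mn − i), i = 1,...,mn, represent each residue class mod n exactly m times. For each residue 0 ≤ r < n, let μ^{(r)} be the partition-type weight for GL_m(ℂ) determined by: the m integers (λ_i + mn − i − r)/n over those i with λ_i + mn − i ≡ r mod n, arranged decreasingly, equal μ^{(r)}_1 + (m−1) ≥ ... ≥ μ^{(r)}_m + 0. Then for all nonzero t_1,...,t_m with t_i^{2n} pairwise distinct, the Schur function s_λ evaluated at the mn eigenvalues (ω^j t_i)_{1≤i≤m, 0≤j<n} (ω a fixed primitive n-th root of unity) equals ε · ∏_{r=0}^{n−1} s_{μ^{(r)}}(t_1^n, ..., t_m^n) for a sign ε ∈ {1, −1} depending only on λ, m, n. -/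

import Mathlib

open Finset

/-- The character (Schur function) of the irreducible representation of
`GL_N(ℂ)` with highest weight `λ₁ ≥ ⋯ ≥ λ_N`, as a ratio of the Weyl
numerator determinant `det (x_j ^ (λ_i + N - i))` by the Vandermonde
determinant `∏_{i<j} (x_i - x_j)`. -/
noncomputable def schurChar (N : ℕ) (lam : Fin N → ℤ) (x : Fin N → ℂ) : ℂ :=
  (Matrix.of fun i j : Fin N => x j ^ (lam i + (N : ℤ) - 1 - (i : ℕ))).det /
    ∏ i : Fin N, ∏ j ∈ Ioi i, (x i - x j)

/-- The `ρ`-shifted exponents `λ_i + N - i` (1-indexed) of a highest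
weight `λ` for `GL_N(ℂ)`. -/
def expo (N : ℕ) (lam : Fin N → ℤ) (i : Fin N) : ℤ :=
  lam i + (N : ℤ) - 1 - (i : ℕ)


lemma det_factor (m n : ℕ) (ω : ℂ) (hω : IsPrimitiveRoot ω n) (e : Fin (m * n) → ℤ)
    (a : Fin n → Fin m → ℤ) (σ : Fin m × Fin n ≃ Fin (m * n))
    (hσ : ∀ p : Fin m × Fin n, e (σ p) = n * a p.2 p.1 + (p.2 : ℕ))
    (t : Fin m → ℂ) (ht : ∀ i, t i ≠ 0) :
    (Matrix.of fun i k : Fin (m * n) => (ω ^ ((finProdFinEquiv.symm k).2 : ℕ) *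
              t (finProdFinEquiv.symm k).1) ^ e i).det =
      ((Equiv.Perm.sign (σ.symm.trans finProdFinEquiv) : ℤ) : ℂ) *
      ((∏ r : Fin n, (Matrix.of fun j i : Fin m => (t i ^ n) ^ a r j).det) *
        (Matrix.of fun p q : Fin m × Fin n =>
          if p.1 = q.1 then t p.1 ^ (p.2 : ℕ) * ω ^ ((q.2 : ℕ) * (p.2 : ℕ)) else 0).det) := by
  rw [← Matrix.det_blockDiagonal, ← Matrix.det_mul,
    ← Matrix.det_submatrix_equiv_self (finProdFinEquiv (m := m) (n := n)).symm,
    ← Matrix.det_permute]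
  congr 1
  ext i k
  obtain ⟨p, rfl⟩ := σ.surjective i
  obtain ⟨q, rfl⟩ := finProdFinEquiv.surjective k
  have hω0 : ω ≠ 0 := hω.ne_zero (by have := q.2.2; omega)
  simp only [Matrix.of_apply, Matrix.submatrix_apply, Equiv.symm_apply_apply, id,
    Equiv.trans_apply, Matrix.mul_apply, Fintype.sum_prod_type, Matrix.blockDiagonal_apply,
    ite_mul, zero_mul, mul_ite, mul_zero, hσ]
  rw [Finset.sum_comm]
  simp only [Finset.sum_ite_eq, Finset.mem_univ, if_true, Finset.sum_ite_eq']
  have h1 : (ω ^ ((q.2 : Fin n) : ℕ)) ^ ((n : ℤ) * a p.2 p.1 + ((p.2 : Fin n) : ℕ)) =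
      ω ^ ((q.2 : ℕ) * (p.2 : ℕ)) := by
    have h2 : (ω ^ ((q.2 : Fin n) : ℕ)) ^ n = 1 := by
      rw [← pow_mul, mul_comm, pow_mul, hω.pow_eq_one, one_pow]
    rw [zpow_add₀ (pow_ne_zero _ hω0), zpow_mul, zpow_natCast, h2, one_zpow, one_mul,
      zpow_natCast, pow_mul]
  rw [mul_zpow, h1, zpow_add₀ (ht _), zpow_mul, zpow_natCast, zpow_natCast]
  ring

lemma det_denominator (N : ℕ) (x : Fin N → ℂ) :
    (Matrix.of fun i k : Fin N => x k ^ ((N : ℤ) - 1 - (i : ℕ))).det =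
      ∏ i : Fin N, ∏ j ∈ Ioi i, (x i - x j) := by
  have h := Matrix.det_projVandermonde (fun _ : Fin N => (1 : ℂ)) x
  simp only [one_mul, mul_one] at h
  rw [← h, ← Matrix.det_transpose]
  congr 1
  ext i j
  simp only [Matrix.transpose_apply, Matrix.of_apply, Matrix.projVandermonde_apply, one_pow,
    one_mul]
  rw [← zpow_natCast]
  congr 1
  rw [Fin.val_rev]
  have := j.2
  omega

lemma sign_cast (z : ℤˣ) : (((z : ℤ)) : ℂ) = 1 ∨ (((z : ℤ)) : ℂ) = -1 := by
  rcases Int.units_eq_one_or z with h | h <;> simp [h]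

/-- Main theorem: suppose the shifted exponents `λ_i + mn - i` of the
dominant weight `λ` of `GL_{mn}(ℂ)` represent each residue class mod `n`
exactly `m` times, and for each residue `r` let `μ⁽ʳ⁾` be the `GL_m(ℂ)`
highest weight whose shifted exponents `μ⁽ʳ⁾_j + m - j` are the integers
`(λ_i + mn - i - r)/n` over the indices `i` in residue class `r`.  Then
there is a sign `ε` (depending only on `λ, m, n`) such that for all nonzero
`t₁, …, t_m` with `tᵢ²ⁿ` pairwise distinct, the Schur function `s_λ` at the
`mn` eigenvalues `ωʲ tᵢ` equals `ε ⬝ ∏_r s_{μ⁽ʳ⁾}(t₁ⁿ, …, t_mⁿ)`. -/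
theorem schur_at_coxeter_factors (m n : ℕ) (hm : 0 < m) (hn : 0 < n)
    (ω : ℂ) (hω : IsPrimitiveRoot ω n)
    (lam : Fin (m * n) → ℤ) (hlam : Antitone lam)
    (hres : ∀ r : ZMod n,
      (univ.filter fun i : Fin (m * n) =>
        ((expo (m * n) lam i : ZMod n) = r)).card = m)
    (μ : Fin n → Fin m → ℤ) (hμantitone : ∀ r, Antitone (μ r))
    (hμ : ∀ r : Fin n,
      ((univ.filter fun i : Fin (m * n) =>
          ((expo (m * n) lam i : ZMod n) = ((r : ℕ) : ZMod n))).val.map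
        fun i => (expo (m * n) lam i - (r : ℕ)) / n) =
      (univ.val.map fun j : Fin m => μ r j + ((m : ℤ) - 1 - (j : ℕ)))) :
    ∃ ε : ℂ, (ε = 1 ∨ ε = -1) ∧
      ∀ t : Fin m → ℂ, (∀ i, t i ≠ 0) →
        (∀ i j, i ≠ j → t i ^ (2 * n) ≠ t j ^ (2 * n)) →
        schurChar (m * n) lam
            (fun k => ω ^ ((finProdFinEquiv.symm k).2 : ℕ) *
              t (finProdFinEquiv.symm k).1) =
          ε * ∏ r : Fin n, schurChar m (μ r) (fun i => t i ^ n) := by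
  have hn' : (n : ℤ) ≠ 0 := by exact_mod_cast hn.ne'
  have hex : ∀ p : Fin m × Fin n, ∃ i, expo (m * n) lam i =
      n * (μ p.2 p.1 + ((m : ℤ) - 1 - (p.1 : ℕ))) + (p.2 : ℕ) := by
    rintro ⟨j, r⟩
    have h : μ r j + ((m : ℤ) - 1 - (j : ℕ)) ∈
        (univ.val.map fun j : Fin m => μ r j + ((m : ℤ) - 1 - (j : ℕ))) :=
      Multiset.mem_map_of_mem _ (Finset.mem_univ j)
    rw [← hμ r, Multiset.mem_map] at h
    obtain ⟨i, hi, hi'⟩ := h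
    have hi2 := (Finset.mem_filter.1 (Finset.mem_def.2 hi)).2
    refine ⟨i, ?_⟩
    have hd : (n : ℤ) ∣ expo (m * n) lam i - (r : ℕ) := by
      rw [← ZMod.intCast_zmod_eq_zero_iff_dvd]
      push_cast
      rw [hi2, sub_self]
    have := Int.mul_ediv_cancel' hd
    rw [hi'] at this
    linarith
  choose s hs using hex
  have hsinj : Function.Injective s := by
    rintro ⟨j, r⟩ ⟨j', r'⟩ h
    have h1 := hs (j, r)
    rw [h, hs (j', r')] at h1
    simp only at h1
    have hr : r = r' := by
      have h2 := congrArg (· % (n : ℤ)) h1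
      simp only [Int.mul_add_emod_self_left] at h2
      have a1 := r.2
      have a2 := r'.2
      rw [Int.emod_eq_of_lt (by omega) (by omega), Int.emod_eq_of_lt (by omega) (by omega)] at h2
      ext
      omega
    subst hr
    have h3 := mul_left_cancel₀ hn' (add_right_cancel h1)
    have : j = j' := by
      rcases lt_trichotomy j j' with h | h | h
      · have := hμantitone r h.le
        have : (j : ℕ) < j' := h
        omega
      · exact h
      · have := hμantitone r h.le
        have : (j' : ℕ) < j := h
        omega
    rw [this]
  have hsbij : Function.Bijective s :=
    (Fintype.bijective_iff_injective_and_card s).2 ⟨hsinj, by simp⟩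
  let σ : Fin m × Fin n ≃ Fin (m * n) := Equiv.ofBijective s hsbij
  let σ0 : Fin m × Fin n ≃ Fin (m * n) :=
    (Equiv.prodCongr (Equiv.refl _) Fin.revPerm).trans finProdFinEquiv
  have hσ0 : ∀ p : Fin m × Fin n, (((m * n : ℕ) : ℤ) - 1 - ((σ0 p : Fin (m * n)) : ℕ)) =
      n * ((m : ℤ) - 1 - (p.1 : ℕ)) + (p.2 : ℕ) := by
    rintro ⟨j, r⟩
    have h1 : ((σ0 (j, r) : Fin (m * n)) : ℕ) = (n - (r + 1)) + n * j := by
      simp [σ0, finProdFinEquiv, Fin.val_rev]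
    have h2 : ((n - (r + 1) : ℕ) : ℤ) = n - (r + 1) := by
      have := r.2
      omega
    rw [h1]
    push_cast [h2]
    ring
  have hs1 := sign_cast (Equiv.Perm.sign (σ.symm.trans finProdFinEquiv))
  have hs0 := sign_cast (Equiv.Perm.sign (σ0.symm.trans finProdFinEquiv))
  refine ⟨((Equiv.Perm.sign (σ.symm.trans finProdFinEquiv) : ℤ) : ℂ) *
    ((Equiv.Perm.sign (σ0.symm.trans finProdFinEquiv) : ℤ) : ℂ), ?_, ?_⟩
  · rcases hs1 with h | h <;> rcases hs0 with h' | h' <;> simp [h, h']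
  intro t ht htd
  have hnum := det_factor m n ω hω (expo (m * n) lam)
    (fun r j => μ r j + ((m : ℤ) - 1 - (j : ℕ))) σ hs t ht
  have hden := det_factor m n ω hω (fun i => ((m * n : ℕ) : ℤ) - 1 - (i : ℕ))
    (fun r j => ((m : ℤ) - 1 - (j : ℕ))) σ0 hσ0 t ht
  have hx : Function.Injective (fun k : Fin (m * n) => ω ^ ((finProdFinEquiv.symm k).2 : ℕ) *
              t (finProdFinEquiv.symm k).1) := by
    intro k k' h
    obtain ⟨⟨i, r⟩, rfl⟩ := finProdFinEquiv.surjective k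
    obtain ⟨⟨i', r'⟩, rfl⟩ := finProdFinEquiv.surjective k'
    simp only [Equiv.symm_apply_apply] at h
    have hone : ∀ a : ℕ, (ω ^ a) ^ (2 * n) = 1 := fun a => by
      rw [← pow_mul, show a * (2 * n) = n * (a * 2) by ring, pow_mul, hω.pow_eq_one, one_pow]
    have hi : i = i' := by
      by_contra hne
      apply htd i i' hne
      have := congrArg (· ^ (2 * n)) h
      simpa only [mul_pow, hone, one_mul] using this
    subst hi
    have := hω.pow_inj r.2 r'.2 (mul_right_cancel₀ (ht i) h)
    rw [Fin.ext this]
  have hV : (∏ i : Fin (m * n), ∏ j ∈ Ioi i,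
      ((ω ^ ((finProdFinEquiv.symm i).2 : ℕ) * t (finProdFinEquiv.symm i).1) -
       (ω ^ ((finProdFinEquiv.symm j).2 : ℕ) * t (finProdFinEquiv.symm j).1))) ≠ 0 := by
    refine Finset.prod_ne_zero_iff.2 fun i _ => Finset.prod_ne_zero_iff.2 fun j hj => ?_
    rw [sub_ne_zero]
    exact fun h => (Finset.mem_Ioi.1 hj).ne (hx h)
  have hden' := det_denominator (m * n) (fun k : Fin (m * n) =>
    ω ^ ((finProdFinEquiv.symm k).2 : ℕ) * t (finProdFinEquiv.symm k).1)
  rw [← hden', hden] at hV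
  have hdm := det_denominator m (fun i => t i ^ n)
  have hnm : ∀ r, (Matrix.of fun i j : Fin m => (t j ^ n) ^ (μ r i + (m : ℤ) - 1 - (i : ℕ))) =
      (Matrix.of fun i j : Fin m => (t j ^ n) ^ (μ r i + ((m : ℤ) - 1 - (i : ℕ)))) := by
    intro r
    ext i j
    simp only [Matrix.of_apply]
    congr 1
    ring
  unfold schurChar
  rw [← hden', hden]
  unfold expo at hnum
  rw [hnum]
  simp only [hnm, ← hdm]
  rw [Finset.prod_div_distrib]
  have hV1 := left_ne_zero_of_mul (right_ne_zero_of_mul hV)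
  have hV2 := right_ne_zero_of_mul (right_ne_zero_of_mul hV)
  rcases hs0 with h' | h' <;> rw [h'] <;> field_simp
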